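/- Suppose the high temperature condition holds with parameters q ∈ [0,1) and K > 0, and let v = v(g,σ) be a bounded function of the disorder and the configuration. Then there exists a constant C depending only on β, h, K such that E( (1/N) Σ_{j=1}^N ⟨σ̇_j σ_j v⟩ - (1-q) ⟨v⟩ )² ≤ C ( E ⟨v⁴⟩ )^{1/2} / N. -/

import Mathlib

open MeasureTheory ProbabilityTheory Real Finset

namespace SK

/-- Index set of pairs `i < j` in `Fin N`. -/
abbrev Pairs (N : ℕ) := {p : Fin N × Fin N // p.1 < p.2}

/-- The disorder: one real coordinate per pair. -/
abbrev Disorder (N : ℕ) := Pairs N → ℝ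

/-- Law of the disorder: i.i.d. standard Gaussians. -/
noncomputable def μdis (N : ℕ) : Measure (Disorder N) :=
  Measure.pi fun _ => gaussianReal 0 1

/-- The symmetric extension `g_{ij}` of the disorder. -/
noncomputable def gval {N : ℕ} (G : Disorder N) (i j : Fin N) : ℝ :=
  if hij : i < j then G ⟨(i, j), hij⟩ else if hji : j < i then G ⟨(j, i), hji⟩ else 0

abbrev Config (N : ℕ) := Fin N → Bool

/-- Spins `±1`. -/
def spin (b : Bool) : ℝ := if b then 1 else -1

/-- (Negative) Hamiltonian of the SK model. -/
noncomputable def ham {N : ℕ} (β h : ℝ) (G : Disorder N) (σ : Config N) : ℝ :=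
  (β / Real.sqrt N) * ∑ p : Pairs N, G p * spin (σ p.1.1) * spin (σ p.1.2)
    + h * ∑ i, spin (σ i)

/-- Partition function. -/
noncomputable def Zpart {N : ℕ} (β h : ℝ) (G : Disorder N) : ℝ :=
  ∑ σ : Config N, Real.exp (ham β h G σ)

/-- Gibbs measure. -/
noncomputable def gibbs {N : ℕ} (β h : ℝ) (G : Disorder N) (σ : Config N) : ℝ :=
  Real.exp (ham β h G σ) / Zpart β h G

/-- Quenched average of a function of one replica. -/
noncomputable def qavg {N : ℕ} (β h : ℝ) (G : Disorder N) (f : Config N → ℝ) : ℝ :=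
  ∑ σ : Config N, f σ * gibbs β h G σ

/-- Quenched average of a function of two replicas. -/
noncomputable def qavg2 {N : ℕ} (β h : ℝ) (G : Disorder N)
    (f : Config N → Config N → ℝ) : ℝ :=
  ∑ σ1 : Config N, ∑ σ2 : Config N, f σ1 σ2 * gibbs β h G σ1 * gibbs β h G σ2

/-- Overlap of two configurations. -/
noncomputable def overlap {N : ℕ} (σ1 σ2 : Config N) : ℝ :=
  (1 / (N : ℝ)) * ∑ i, spin (σ1 i) * spin (σ2 i)

/-- The high temperature condition `E⟨(R₁₂ - q)⁴⟩ ≤ K/N²`. -/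
def highTemp (N : ℕ) (β h q K : ℝ) : Prop :=
  ∫ G, qavg2 β h G (fun σ1 σ2 => (overlap σ1 σ2 - q) ^ 4) ∂(μdis N) ≤ K / (N : ℝ) ^ 2

/-- Magnetization `⟨σ_i⟩`. -/
noncomputable def mavg {N : ℕ} (β h : ℝ) (G : Disorder N) (i : Fin N) : ℝ :=
  qavg β h G fun σ => spin (σ i)

/-- Local field `ℓ_i`. -/
noncomputable def locField {N : ℕ} (G : Disorder N) (i : Fin N) (σ : Config N) : ℝ :=
  (1 / Real.sqrt N) * ∑ j ∈ Finset.univ.erase i, gval G i j * spin (σ j)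

/-- The field `r_i`. -/
noncomputable def rfield {N : ℕ} (β h q : ℝ) (G : Disorder N) (i : Fin N) : ℝ :=
  (1 / Real.sqrt N) * ∑ j ∈ Finset.univ.erase i, gval G i j * mavg β h G j
    - β * (1 - q) * mavg β h G i

/-- Gaussian density `φ_{μ,v}` with mean `μ` and variance `v`. -/
noncomputable def gaussDens (μ v x : ℝ) : ℝ :=
  (1 / (Real.sqrt (2 * π) * Real.sqrt v)) * Real.exp (-(x - μ) ^ 2 / (2 * v))

/-- Mixture-Gaussian density `ψ_{a,b,μ,v}`. -/
noncomputable def mixDens (a b μ v x : ℝ) : ℝ :=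
  Real.cosh (a * x + b) * Real.exp (-(x - μ) ^ 2 / (2 * v)) /
    (Real.sqrt (2 * π) * Real.sqrt v * Real.cosh (a * μ + b) * Real.exp (a ^ 2 * v / 2))


lemma spin_mul_self (b : Bool) : spin b * spin b = 1 := by
  cases b <;> simp [spin]

lemma Zpart_pos {N : ℕ} (β h : ℝ) (G : Disorder N) : 0 < Zpart β h G :=
  Finset.sum_pos (fun _ _ => Real.exp_pos _) Finset.univ_nonempty

lemma gibbs_nonneg {N : ℕ} (β h : ℝ) (G : Disorder N) (σ : Config N) : 0 ≤ gibbs β h G σ :=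
  div_nonneg (Real.exp_pos _).le (Zpart_pos β h G).le

lemma sum_gibbs {N : ℕ} (β h : ℝ) (G : Disorder N) : ∑ σ : Config N, gibbs β h G σ = 1 := by
  unfold gibbs
  rw [← Finset.sum_div]
  exact div_self (Zpart_pos β h G).ne'

lemma measurable_gibbs {N : ℕ} (β h : ℝ) (σ : Config N) :
    Measurable fun G => gibbs β h G σ := by
  unfold gibbs Zpart ham
  fun_prop

instance (N : ℕ) : IsProbabilityMeasure (μdis N) := by
  unfold μdis
  infer_instance

lemma qavg_const {N : ℕ} (β h : ℝ) (G : Disorder N) (c : ℝ) : qavg β h G (fun _ => c) = c := by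
  rw [qavg, ← Finset.mul_sum, sum_gibbs, mul_one]

lemma qavg_nonneg {N : ℕ} (β h : ℝ) (G : Disorder N) {f : Config N → ℝ} (hf : ∀ σ, 0 ≤ f σ) :
    0 ≤ qavg β h G f :=
  Finset.sum_nonneg fun σ _ => mul_nonneg (hf σ) (gibbs_nonneg β h G σ)

lemma abs_qavg_le {N : ℕ} (β h : ℝ) (G : Disorder N) {f : Config N → ℝ} {M : ℝ}
    (hf : ∀ σ, |f σ| ≤ M) : |qavg β h G f| ≤ M := by
  calc |qavg β h G f| ≤ ∑ σ, |f σ * gibbs β h G σ| := Finset.abs_sum_le_sum_abs _ _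
    _ ≤ ∑ σ, M * gibbs β h G σ := by
        refine Finset.sum_le_sum fun σ _ => ?_
        rw [abs_mul, abs_of_nonneg (gibbs_nonneg β h G σ)]
        exact mul_le_mul_of_nonneg_right (hf σ) (gibbs_nonneg β h G σ)
    _ = M := qavg_const β h G M

lemma measurable_qavg {N : ℕ} (β h : ℝ) {f : Disorder N → Config N → ℝ}
    (hf : ∀ σ, Measurable fun G => f G σ) : Measurable fun G => qavg β h G (f G) :=
  Finset.measurable_sum _ fun σ _ => (hf σ).mul (measurable_gibbs β h σ)

lemma qavg2_eq_qavg_qavg {N : ℕ} (β h : ℝ) (G : Disorder N) (f : Config N → Config N → ℝ) :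
    qavg2 β h G f = qavg β h G fun σ => qavg β h G (f σ) := by
  simp only [qavg2, qavg, Finset.sum_mul]
  exact Finset.sum_congr rfl fun σ _ => Finset.sum_congr rfl fun τ _ => by ring

/-- Cauchy–Schwarz inequality for two-replica averages. -/
lemma qavg2_mul_sq_le {N : ℕ} (β h : ℝ) (G : Disorder N) (f g : Config N → Config N → ℝ) :
    qavg2 β h G (fun σ τ => f σ τ * g σ τ) ^ 2 ≤
      qavg2 β h G (fun σ τ => f σ τ ^ 2) * qavg2 β h G (fun σ τ => g σ τ ^ 2) := by
  simp only [qavg2, ← Fintype.sum_prod_type']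
  refine Finset.sum_sq_le_sum_mul_sum_of_sq_le_mul _ ?_ ?_ ?_
  · exact fun p _ => mul_nonneg (mul_nonneg (sq_nonneg _) (gibbs_nonneg ..)) (gibbs_nonneg ..)
  · exact fun p _ => mul_nonneg (mul_nonneg (sq_nonneg _) (gibbs_nonneg ..)) (gibbs_nonneg ..)
  · exact fun p _ => le_of_eq (by ring)

lemma qavg2_sq_le {N : ℕ} (β h : ℝ) (G : Disorder N) (f : Config N → Config N → ℝ) :
    qavg2 β h G f ^ 2 ≤ qavg2 β h G (fun σ τ => f σ τ ^ 2) := by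
  simpa [qavg2_eq_qavg_qavg, qavg_const] using qavg2_mul_sq_le β h G f fun _ _ => 1

lemma qavg_overlap {N : ℕ} (β h : ℝ) (G : Disorder N) (σ : Config N) :
    qavg β h G (overlap σ) = (1 / (N : ℝ)) * ∑ j, spin (σ j) * mavg β h G j := by
  simp only [qavg, mavg, overlap, Finset.mul_sum, Finset.sum_mul]
  rw [Finset.sum_comm]
  exact Finset.sum_congr rfl fun j _ => Finset.sum_congr rfl fun τ _ => by ring

/-- The average of the `⟨σ̇_j σ_j v⟩`, recentred at `(1 - q)⟨v⟩`, is minus the two-replica average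
of `(R₁₂ - q) v`. -/
lemma sdot_sigma_eq {N : ℕ} (hN : N ≠ 0) (β h q : ℝ) (G : Disorder N) (u : Config N → ℝ) :
    (1 / (N : ℝ)) * ∑ j : Fin N,
        qavg β h G (fun σ => (spin (σ j) - mavg β h G j) * spin (σ j) * u σ)
      - (1 - q) * qavg β h G u
      = -qavg2 β h G (fun σ τ => (overlap σ τ - q) * u σ) := by
  have hN' : (N : ℝ) ≠ 0 := Nat.cast_ne_zero.mpr hN
  have inner (σ : Config N) : qavg β h G (fun τ => (overlap σ τ - q) * u σ)
      = ((1 / (N : ℝ)) * ∑ j, spin (σ j) * mavg β h G j - q) * u σ := by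
    rw [← qavg_overlap]
    have hq := qavg_const β h G q
    unfold qavg at hq ⊢
    rw [← hq, ← Finset.sum_sub_distrib, Finset.sum_mul]
    simp only [hq]
    exact Finset.sum_congr rfl fun τ _ => by ring
  have expand (σ : Config N) :
      (1 / (N : ℝ)) * ∑ j, (spin (σ j) - mavg β h G j) * spin (σ j)
        = 1 - (1 / (N : ℝ)) * ∑ j, spin (σ j) * mavg β h G j := by
    simp only [sub_mul, spin_mul_self, Finset.sum_sub_distrib, mul_comm (mavg β h G _)]
    simp [mul_sub, hN']
  simp only [qavg2_eq_qavg_qavg, inner]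
  simp only [qavg]
  rw [Finset.sum_comm, Finset.mul_sum, Finset.mul_sum, ← Finset.sum_sub_distrib,
    ← Finset.sum_neg_distrib]
  refine Finset.sum_congr rfl fun σ _ => ?_
  rw [← Finset.sum_mul, ← Finset.sum_mul]
  linear_combination (u σ * gibbs β h G σ) * expand σ

lemma sq_sdot_sigma_le {N : ℕ} (hN : N ≠ 0) (β h q : ℝ) (G : Disorder N) (u : Config N → ℝ) :
    ((1 / (N : ℝ)) * ∑ j : Fin N,
        qavg β h G (fun σ => (spin (σ j) - mavg β h G j) * spin (σ j) * u σ)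
      - (1 - q) * qavg β h G u) ^ 2
      ≤ √(qavg2 β h G fun σ τ => (overlap σ τ - q) ^ 4) * √(qavg β h G fun σ => u σ ^ 4) := by
  rw [sdot_sigma_eq hN, neg_sq]
  refine (qavg2_mul_sq_le β h G (fun σ τ => overlap σ τ - q) fun σ _ => u σ).trans ?_
  have hR := qavg2_sq_le β h G fun σ τ => (overlap σ τ - q) ^ 2
  have hu := qavg2_sq_le β h G fun σ _ => u σ ^ 2
  simp only [← pow_mul, Nat.reduceMul] at hR hu
  rw [qavg2_eq_qavg_qavg _ _ _ fun σ _ => u σ ^ 4] at hu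
  simp only [qavg_const] at hu
  refine mul_le_mul (Real.le_sqrt_of_sq_le hR) (Real.le_sqrt_of_sq_le hu) ?_ (Real.sqrt_nonneg _)
  rw [qavg2_eq_qavg_qavg]
  exact qavg_nonneg _ _ _ fun _ => qavg_nonneg _ _ _ fun _ => sq_nonneg _

/-- Cauchy–Schwarz inequality for square roots of bounded nonnegative functions. -/
lemma integral_sqrt_mul_sqrt_le {Ω : Type*} [MeasurableSpace Ω] {μ : Measure Ω}
    [IsFiniteMeasure μ] {A B : Ω → ℝ} (hA : Measurable A) (hB : Measurable B)
    (hA0 : ∀ x, 0 ≤ A x) (hB0 : ∀ x, 0 ≤ B x) {a b : ℝ} (hAa : ∀ x, |A x| ≤ a)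
    (hBb : ∀ x, |B x| ≤ b) :
    Integrable (fun x => √(A x) * √(B x)) μ ∧
      ∫ x, √(A x) * √(B x) ∂μ ≤ √(∫ x, A x ∂μ) * √(∫ x, B x ∂μ) := by
  have memLp {F : Ω → ℝ} {c : ℝ} (hF : Measurable F) (hFc : ∀ x, |F x| ≤ c) :
      MemLp (fun x => √(F x)) (ENNReal.ofReal 2) μ :=
    MemLp.of_bound hF.sqrt.aestronglyMeasurable √c <| ae_of_all _ fun x => by
      rw [Real.norm_of_nonneg (Real.sqrt_nonneg _)]
      exact Real.sqrt_le_sqrt ((le_abs_self _).trans (hFc x))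
  have hA2 := memLp hA hAa
  have hB2 := memLp hB hBb
  refine ⟨?_, ?_⟩
  · rw [ENNReal.ofReal_ofNat] at hA2 hB2
    exact hA2.integrable_mul hB2
  · have key := integral_mul_le_Lp_mul_Lq_of_nonneg Real.HolderConjugate.two_two
      (ae_of_all μ fun x => Real.sqrt_nonneg (A x))
      (ae_of_all μ fun x => Real.sqrt_nonneg (B x)) hA2 hB2
    simpa only [Real.rpow_two, Real.sq_sqrt (hA0 _), Real.sq_sqrt (hB0 _),
      ← Real.sqrt_eq_rpow] using key

/-- Estimate (3.9). -/
theorem est_sdot_sigma (β h K : ℝ) (hβ : 0 < β) (hK : 0 < K) :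
    ∃ C : ℝ, 0 < C ∧ ∀ (N : ℕ) (q : ℝ), 2 ≤ N → 0 ≤ q → q < 1 →
      highTemp N β h q K →
      ∀ v : Disorder N → Config N → ℝ,
      (∀ σ, Measurable fun G => v G σ) →
      (∃ M : ℝ, ∀ G σ, |v G σ| ≤ M) →
        ∫ G, ((1 / (N : ℝ)) * ∑ j : Fin N,
              qavg β h G (fun σ => (spin (σ j) - mavg β h G j) * spin (σ j) * v G σ)
            - (1 - q) * qavg β h G (fun σ => v G σ)) ^ 2 ∂(μdis N)
        ≤ C * Real.sqrt (∫ G, qavg β h G (fun σ => v G σ ^ 4) ∂(μdis N)) / N := by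
  refine ⟨√K, Real.sqrt_pos.mpr hK, fun N q hN _ _ hT v hv hb => ?_⟩
  obtain ⟨M, hM⟩ := hb
  have overlap_le (σ τ : Config N) :
      |(overlap σ τ - q) ^ 4| ≤ ∑ σ' : Config N, ∑ τ' : Config N, |(overlap σ' τ' - q) ^ 4| :=
    (Finset.single_le_sum (f := fun τ' => |(overlap σ τ' - q) ^ 4|)
      (fun _ _ => abs_nonneg _) (Finset.mem_univ τ)).trans
    (Finset.single_le_sum (f := fun σ' => ∑ τ' : Config N, |(overlap σ' τ' - q) ^ 4|)
      (fun _ _ => Finset.sum_nonneg fun _ _ => abs_nonneg _) (Finset.mem_univ σ))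
  obtain ⟨hint, hCS⟩ := integral_sqrt_mul_sqrt_le (μ := μdis N)
    (A := fun G => qavg2 β h G fun σ τ => (overlap σ τ - q) ^ 4)
    (B := fun G => qavg β h G fun σ => v G σ ^ 4)
    (by
      simp only [qavg2_eq_qavg_qavg]
      exact measurable_qavg β h fun σ => measurable_qavg β h fun τ => measurable_const)
    (measurable_qavg β h fun σ => (hv σ).pow_const 4)
    (fun G => by
      rw [qavg2_eq_qavg_qavg]
      exact qavg_nonneg _ _ _ fun σ => qavg_nonneg _ _ _ fun τ => by positivity)
    (fun G => qavg_nonneg _ _ _ fun σ => by positivity)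
    (fun G => by
      rw [qavg2_eq_qavg_qavg]
      exact abs_qavg_le β h G fun σ => abs_qavg_le β h G (overlap_le σ))
    (fun G => abs_qavg_le β h G fun σ => by
      rw [abs_pow]
      exact pow_le_pow_left₀ (abs_nonneg _) (hM G σ) 4)
  have hRK : √(∫ G, qavg2 β h G (fun σ τ => (overlap σ τ - q) ^ 4) ∂(μdis N)) ≤ √K / N := by
    refine (Real.sqrt_le_sqrt hT).trans_eq ?_
    rw [Real.sqrt_div hK.le, Real.sqrt_sq (Nat.cast_nonneg N)]
  calc _ ≤ ∫ G, √(qavg2 β h G fun σ τ => (overlap σ τ - q) ^ 4)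
          * √(qavg β h G fun σ => v G σ ^ 4) ∂(μdis N) :=
        integral_mono_of_nonneg (ae_of_all _ fun _ => sq_nonneg _) hint
          (ae_of_all _ fun G => sq_sdot_sigma_le (by omega) β h q G (v G))
    _ ≤ _ := hCS
    _ ≤ √K / N * √(∫ G, qavg β h G (fun σ => v G σ ^ 4) ∂(μdis N)) :=
        mul_le_mul_of_nonneg_right hRK (Real.sqrt_nonneg _)
    _ = _ := by ring

end SK
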